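/- Let U be a normal ultrafilter on a measurable cardinal δ and let κ be a singular strong limit cardinal of cofinality δ with κ^δ = κ⁺. Then the ordinal λ = ((κ⁺)⁺)^{Ult(V,U)} (the cardinal successor of κ⁺ as computed in Ult(V,U)) satisfies λ < (κ⁺)⁺ and cof(λ) = κ⁺. -/

import Mathlib

noncomputable section

open Cardinal Set

namespace MU

/-- The type of ordinals below the initial ordinal of `δ`, serving as the underlying
set of the cardinal `δ` and indexing the ultrapower. -/
abbrev Idx (δ : Cardinal.{0}) : Type 1 := {o : Ordinal.{0} // o < δ.ord}

/-- A filter `F` is `κ`-complete (equivalently, `<κ`-closed): it is closed under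
intersections of fewer than `κ` of its members. -/
def IsCComplete (κ : Cardinal.{0}) {X : Type*} (F : Filter X) : Prop :=
  ∀ (ι : Type) (t : ι → Set X), #ι < κ → (∀ j, t j ∈ F) → (⋂ j, t j) ∈ F

/-- `U` is a normal ultrafilter on the measurable cardinal `δ`: `δ` is uncountable and
`U` is a `δ`-complete nonprincipal ultrafilter on `δ` such that every function that is
regressive on a set in `U` is constant on a set in `U`. -/
structure IsNormalUltrafilter (δ : Cardinal.{0}) (U : Ultrafilter (Idx δ)) : Prop where
  uncountable : ℵ₀ < δ
  complete : IsCComplete δ (U : Filter (Idx δ))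
  nonprincipal : ∀ i : Idx δ, ({i} : Set (Idx δ)) ∉ U
  normal : ∀ f : Idx δ → Ordinal.{0}, { i : Idx δ | f i < i.1 } ∈ U →
    ∃ c : Ordinal.{0}, { i : Idx δ | f i = c } ∈ U

variable {δ : Cardinal.{0}} {U : Ultrafilter (Idx δ)}

/-- The Łoś ordering on representatives of ordinals of the ultrapower `Ult(V,U)`. -/
def ultLT (U : Ultrafilter (Idx δ)) (f g : Idx δ → Ordinal.{0}) : Prop :=
  { i : Idx δ | f i < g i } ∈ U

theorem ultLT_wf (hU : IsNormalUltrafilter δ U) : WellFounded (ultLT U) := by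
  haveI : IsIrrefl (Idx δ → Ordinal.{0}) (ultLT U) := by
    constructor
    intro f hf
    have h : ({ i : Idx δ | f i < f i } : Set (Idx δ)) = ∅ := by ext i; simp
    rw [ultLT, h] at hf
    exact Filter.empty_notMem (U : Filter (Idx δ)) hf
  haveI : IsTrans (Idx δ → Ordinal.{0}) (ultLT U) := by
    constructor
    intro f g h hfg hgh
    have hsub : ({ i : Idx δ | f i < g i } ∩ { i : Idx δ | g i < h i } : Set (Idx δ)) ⊆
        { i : Idx δ | f i < h i } := fun i hi => show f i < h i from lt_trans hi.1 hi.2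
    exact Filter.mem_of_superset (Filter.inter_mem hfg hgh) hsub
  haveI : IsStrictOrder (Idx δ → Ordinal.{0}) (ultLT U) := ⟨⟩
  rw [RelEmbedding.wellFounded_iff_isEmpty]
  constructor
  intro g
  have hmem : ∀ n : ℕ, { i : Idx δ | g (n + 1) i < g n i } ∈ U :=
    fun n => g.map_rel_iff.2 (Nat.lt_succ_self n)
  have hint : (⋂ n : ℕ, { i : Idx δ | g (n + 1) i < g n i }) ∈ U := by
    refine hU.complete ℕ _ ?_ hmem
    rw [Cardinal.mk_nat]
    exact hU.uncountable
  obtain ⟨i, hi⟩ := Ultrafilter.nonempty_of_mem hint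
  have hdesc : ∀ n : ℕ, (fun n => g n i) (n + 1) < (fun n => g n i) n :=
    fun n => Set.mem_iInter.1 hi n
  exact (RelEmbedding.wellFounded_iff_isEmpty.1 Ordinal.lt_wf).false
    (RelEmbedding.natGT (fun n => g n i) hdesc)

/-- The ordinal represented by `f` in the transitive collapse of the ultrapower
`Ult(V,U)`, i.e. the rank of `f` in the (well-founded) Łoś ordering. -/
def ordRank (hU : IsNormalUltrafilter δ U) (f : Idx δ → Ordinal.{0}) : Ordinal.{0} :=
  sInf { o : Ordinal.{0} | Ordinal.lift.{1} o = ((ultLT_wf hU).apply f).rank }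

/-- The image of an ordinal under the ultrapower embedding `j_U : V → Ult(V,U)`. -/
def jU (hU : IsNormalUltrafilter δ U) (o : Ordinal.{0}) : Ordinal.{0} :=
  ordRank hU fun _ => o

/-- The set of ordinals that is the transitive collapse of the element of the
ultrapower `Ult(V,U)` represented by the function `f`. -/
def ultSet (hU : IsNormalUltrafilter δ U) (f : Idx δ → Set Ordinal.{0}) :
    Set Ordinal.{0} :=
  { o : Ordinal.{0} |
    ∃ g : Idx δ → Ordinal.{0}, { i : Idx δ | g i ∈ f i } ∈ U ∧ ordRank hU g = o }

/-- A set of ordinals is (the transitive collapse of) an element of the ultrapower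
`Ult(V,U)`. -/
def InUlt (hU : IsNormalUltrafilter δ U) (A : Set Ordinal.{0}) : Prop :=
  ∃ f : Idx δ → Set Ordinal.{0}, (∀ i, BddAbove (f i)) ∧ A = ultSet hU f

/-- The least upper bound of a set of ordinals. -/
def lub (A : Set Ordinal.{0}) : Ordinal.{0} :=
  sSup ((fun o => o + 1) '' A)

/-- Hamkins: a set `A` of ordinals is fresh over `Ult(V,U)` if `A ∉ Ult(V,U)` but
`A ∩ α ∈ Ult(V,U)` for every `α < lub A`. -/
def Fresh (hU : IsNormalUltrafilter δ U) (A : Set Ordinal.{0}) : Prop :=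
  ¬ InUlt hU A ∧ ∀ α < lub A, InUlt hU (A ∩ Iio α)

/-- `A` is an unbounded subset of the ordinal `l`. -/
def UnbSub (A : Set Ordinal.{0}) (l : Ordinal.{0}) : Prop :=
  A ⊆ Iio l ∧ ∀ b < l, ∃ a ∈ A, b ≤ a

/-- `A` is a closed subset of the ordinal `l`: it contains the suprema of all of its
nonempty subsets that are bounded below `l`. -/
def ClosedIn (A : Set Ordinal.{0}) (l : Ordinal.{0}) : Prop :=
  ∀ S ⊆ A, S.Nonempty → sSup S < l → sSup S ∈ A

/-- The set of limit points of a set of ordinals. -/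
def limitPts (A : Set Ordinal.{0}) : Set Ordinal.{0} :=
  { b : Ordinal.{0} | (A ∩ Iio b).Nonempty ∧ sSup (A ∩ Iio b) = b }

/-- `S` is a stationary subset of the ordinal `l`. -/
def StationaryIn (S : Set Ordinal.{0}) (l : Ordinal.{0}) : Prop :=
  S ⊆ Iio l ∧ ∀ D : Set Ordinal.{0}, ClosedIn D l → UnbSub D l → (S ∩ D).Nonempty

/-- The order type of the set of ordinals `C` is at most `o`. -/
def otpLE (C : Set Ordinal.{0}) (o : Ordinal.{0}) : Prop :=
  ∃ g : Ordinal.{0} → Ordinal.{0}, (∀ a ∈ C, g a < o) ∧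
    ∀ a ∈ C, ∀ b ∈ C, a < b → g a < g b

/-- The order type of the set of ordinals `C` is (strictly) less than `o`. -/
def otpLT (C : Set Ordinal.{0}) (o : Ordinal.{0}) : Prop :=
  ∃ o' < o, otpLE C o'

/-- `C` is a `□(Θ)`-sequence, where `Θ` is (the initial ordinal of) an uncountable
regular cardinal. -/
structure IsSquareSeq (Θ : Ordinal.{0}) (C : Ordinal.{0} → Set Ordinal.{0}) : Prop where
  closed : ∀ γ < Θ, Order.IsSuccLimit γ → ClosedIn (C γ) γ
  unbounded : ∀ γ < Θ, Order.IsSuccLimit γ → UnbSub (C γ) γ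
  coherent : ∀ γ < Θ, Order.IsSuccLimit γ → ∀ β ∈ limitPts (C γ), β < γ → C β = C γ ∩ Iio β
  nontrivial : ¬ ∃ D : Set Ordinal.{0}, ClosedIn D Θ ∧ UnbSub D Θ ∧
    ∀ γ ∈ limitPts D, γ < Θ → D ∩ Iio γ = C γ

/-- `C` is a `□_κ`-sequence: a `□(κ⁺)`-sequence all of whose clubs have order type
at most `κ`. -/
def IsSquareKappaSeq (κ : Cardinal.{0}) (C : Ordinal.{0} → Set Ordinal.{0}) : Prop :=
  IsSquareSeq (Order.succ κ).ord C ∧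
    ∀ γ < (Order.succ κ).ord, Order.IsSuccLimit γ → otpLE (C γ) κ.ord

/-- `κ` is a weakly compact cardinal: `κ` is uncountable and every coloring of the
pairs of ordinals below `κ` in fewer than `κ` colors has a homogeneous set of size `κ`. -/
def IsWeaklyCompact (κ : Cardinal.{0}) : Prop :=
  ℵ₀ < κ ∧ ∀ (ν : Type) (c : Ordinal.{0} → Ordinal.{0} → ν), #ν < κ →
    ∃ H : Set Ordinal.{0}, H ⊆ Iio κ.ord ∧ Cardinal.lift.{1} κ ≤ #H ∧
      ∀ a ∈ H, ∀ b ∈ H, ∀ a' ∈ H, ∀ b' ∈ H, a < b → a' < b' → c a b = c a' b'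

/-- `κ` is a strongly compact cardinal: every `κ`-complete filter (on any set)
extends to a `κ`-complete ultrafilter. -/
def IsStronglyCompact (κ : Cardinal.{0}) : Prop :=
  ∀ (X : Type) (F : Filter X), IsCComplete κ F →
    ∃ G : Ultrafilter X, F ≤ (G : Filter X) ∧ IsCComplete κ (G : Filter X)

/-- `κ` is a singular cardinal. -/
def IsSingular (κ : Cardinal.{0}) : Prop :=
  ℵ₀ ≤ κ ∧ κ.ord.cof < κ

/-- The cofinality of the ordinal `l` as computed inside the ultrapower `Ult(V,U)`
(as an ordinal, i.e. the image of the ultrapower's cofinality under the transitive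
collapse). -/
def cofUlt (hU : IsNormalUltrafilter δ U) (l : Ordinal.{0}) : Ordinal.{0} :=
  sInf { c : Ordinal.{0} | ∃ f : Idx δ → Ordinal.{0},
    ordRank hU f = l ∧ ordRank hU (fun i => ((f i).cof).ord) = c }

/-- The ordinal `o` is (the transitive collapse of) a cardinal of the ultrapower
`Ult(V,U)`. -/
def CardInUlt (hU : IsNormalUltrafilter δ U) (o : Ordinal.{0}) : Prop :=
  ∃ f : Idx δ → Ordinal.{0}, ordRank hU f = o ∧
    { i : Idx δ | ((f i).card).ord = f i } ∈ U

/-- The ordinal `o` is (the transitive collapse of) a regular cardinal of the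
ultrapower `Ult(V,U)`. -/
def RegularInUlt (hU : IsNormalUltrafilter δ U) (o : Ordinal.{0}) : Prop :=
  ∃ f : Idx δ → Ordinal.{0}, ordRank hU f = o ∧
    { i : Idx δ | ((f i).card).IsRegular ∧ ((f i).card).ord = f i } ∈ U

/-- The cardinal successor of the ordinal `o` as computed inside the ultrapower
`Ult(V,U)`: the least ordinal above `o` that is a cardinal in `Ult(V,U)`. -/
def succInUlt (hU : IsNormalUltrafilter δ U) (o : Ordinal.{0}) : Ordinal.{0} :=
  sInf { c : Ordinal.{0} | o < c ∧ CardInUlt hU c }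

/-- The cardinality of a set of ordinals, as an (initial) ordinal: the least ordinal
`o` such that `s` is the image of a function defined on the ordinals below `o`. -/
def setCardOrd (s : Set Ordinal.{0}) : Ordinal.{0} :=
  sInf { o : Ordinal.{0} | ∃ g : Ordinal.{0} → Ordinal.{0}, s ⊆ g '' Iio o }

theorem setOf_lt_or_eq_or_gt_mem (f g : Idx δ → Ordinal.{0}) :
    ultLT U f g ∨ { i | f i = g i } ∈ U ∨ ultLT U g f := by
  by_contra! h
  obtain ⟨h₁, h₂, h₃⟩ := h
  rw [ultLT, ← Ultrafilter.compl_mem_iff_notMem] at h₁ h₃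
  rw [← Ultrafilter.compl_mem_iff_notMem] at h₂
  obtain ⟨i, hi₁, hi₂, hi₃⟩ :=
    Ultrafilter.nonempty_of_mem (Filter.inter_mem h₁ (Filter.inter_mem h₂ h₃))
  rcases lt_trichotomy (f i) (g i) with h | h | h
  exacts [hi₁ h, hi₂ h, hi₃ h]

/-- Almost everywhere equal functions have the same rank in the Łoś ordering. -/
theorem rank_congr (hU : IsNormalUltrafilter δ U) {f g : Idx δ → Ordinal.{0}}
    (h : { i | f i = g i } ∈ U) :
    ((ultLT_wf hU).apply f).rank = ((ultLT_wf hU).apply g).rank := by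
  have key : ∀ f g : Idx δ → Ordinal.{0}, { i | f i = g i } ∈ U →
      ((ultLT_wf hU).apply f).rank ≤ ((ultLT_wf hU).apply g).rank := by
    intro f g h
    rw [Acc.rank_eq]
    refine Ordinal.iSup_le fun b => Order.succ_le_of_lt ?_
    refine Acc.rank_lt_of_rel ((ultLT_wf hU).apply g) ?_
    filter_upwards [b.2, h] with i hi hi'
    exact hi' ▸ hi
  refine (key f g h).antisymm (key g f ?_)
  filter_upwards [h] with i hi using hi.symm

instance small_idx : Small.{0} (Idx δ) :=
  inferInstanceAs (Small.{0} (Iio δ.ord))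

theorem mk_idx : #(Idx δ) = Cardinal.lift.{1} δ := by
  have := Cardinal.mk_Iio_ordinal δ.ord
  rwa [Cardinal.card_ord] at this

theorem mk_idx_fun (o : Ordinal.{0}) :
    #(Idx δ → Iio o) = Cardinal.lift.{1} (o.card ^ δ) := by
  simp [Cardinal.mk_Iio_ordinal, mk_idx]

/-- The rank of a function bounded by `o` has cardinality at most `|o| ^ δ`. -/
theorem card_rank_le (hU : IsNormalUltrafilter δ U) {f : Idx δ → Ordinal.{0}}
    {o : Ordinal.{0}} (h : { i | f i < o } ∈ U) :
    ((ultLT_wf hU).apply f).rank.card ≤ Cardinal.lift.{1} (o.card ^ δ) := by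
  have ho : 0 < o := by
    obtain ⟨i, hi⟩ := Ultrafilter.nonempty_of_mem h
    exact pos_of_gt hi
  have hex : ∀ a : Iio ((ultLT_wf hU).apply f).rank, ∃ g : Idx δ → Iio o,
      ((ultLT_wf hU).apply fun i => (g i).1).rank = a.1 := by
    intro a
    obtain ⟨g, hg, hga⟩ := Acc.mem_range_rank_of_le ((ultLT_wf hU).apply f) a.2.le
    have hgf : ultLT U g f := by
      rcases setOf_lt_or_eq_or_gt_mem (U := U) g f with h' | h' | h'
      · exact h'
      · exact absurd (hga.symm.trans (rank_congr hU h')) a.2.ne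
      · have := Acc.rank_lt_of_rel ((ultLT_wf hU).apply g) h'
        exact absurd (this.trans_eq hga) a.2.not_gt
    refine ⟨fun i => if hi : g i < o then ⟨g i, hi⟩ else ⟨0, ho⟩, ?_⟩
    refine (rank_congr hU ?_).trans hga
    filter_upwards [hgf, h] with i hi hi'
    rw [dif_pos (hi.trans hi')]
  choose G hG using hex
  have hinj : Function.Injective G := fun a b hab => Subtype.ext <| by
    rw [← hG a, ← hG b, hab]
  have := Cardinal.mk_le_of_injective ((Equiv.ulift.{2}.symm.injective).comp hinj)
  rw [Cardinal.mk_uLift, mk_idx_fun, Cardinal.mk_Iio_ordinal] at this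
  exact Cardinal.lift_le.1 this

theorem lift_ordRank (hU : IsNormalUltrafilter δ U) (f : Idx δ → Ordinal.{0}) :
    Ordinal.lift.{1, 0} (ordRank hU f) = ((ultLT_wf hU).apply f).rank := by
  have hmem : ∃ o : Ordinal.{0}, Ordinal.lift.{1, 0} o = ((ultLT_wf hU).apply f).rank := by
    refine Ordinal.mem_range_lift_of_card_le.{0, 1} (card_rank_le hU (o := (⨆ i, f i) + 1) ?_)
    refine Filter.univ_mem' fun i => Set.mem_ofPred.2 (Order.lt_add_one_iff.2 ?_)
    exact le_ciSup Ordinal.bddAbove_of_small i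
  exact csInf_mem
    (s := { o : Ordinal.{0} | Ordinal.lift.{1, 0} o = ((ultLT_wf hU).apply f).rank }) hmem

theorem ordRank_lt_ordRank_iff (hU : IsNormalUltrafilter δ U) {f g : Idx δ → Ordinal.{0}} :
    ordRank hU f < ordRank hU g ↔ ultLT U f g := by
  rw [← Ordinal.lift_lt.{1}, lift_ordRank, lift_ordRank]
  refine ⟨fun h => ?_, fun h => Acc.rank_lt_of_rel ((ultLT_wf hU).apply g) h⟩
  rcases setOf_lt_or_eq_or_gt_mem (U := U) f g with h' | h' | h'
  · exact h'
  · exact absurd (rank_congr hU h') h.ne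
  · exact absurd (Acc.rank_lt_of_rel ((ultLT_wf hU).apply f) h') h.not_gt

theorem ordRank_le_ordRank_iff (hU : IsNormalUltrafilter δ U) {f g : Idx δ → Ordinal.{0}} :
    ordRank hU f ≤ ordRank hU g ↔ { i | f i ≤ g i } ∈ U := by
  rw [← not_lt, ordRank_lt_ordRank_iff, ultLT, ← Ultrafilter.compl_mem_iff_notMem]
  simp [Set.compl_ofPred]

theorem ordRank_eq_ordRank_iff (hU : IsNormalUltrafilter δ U) {f g : Idx δ → Ordinal.{0}} :
    ordRank hU f = ordRank hU g ↔ { i | f i = g i } ∈ U := by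
  rw [le_antisymm_iff, ordRank_le_ordRank_iff, ordRank_le_ordRank_iff]
  refine Filter.inter_mem_iff.symm.trans ?_
  simp only [le_antisymm_iff]
  rfl

theorem card_ordRank_le (hU : IsNormalUltrafilter δ U) {f : Idx δ → Ordinal.{0}}
    {o : Ordinal.{0}} (h : { i | f i < o } ∈ U) : (ordRank hU f).card ≤ o.card ^ δ := by
  rw [← Cardinal.lift_le.{1}, Ordinal.lift_card, lift_ordRank]
  exact card_rank_le hU h

theorem le_jU (hU : IsNormalUltrafilter δ U) (o : Ordinal.{0}) : o ≤ jU hU o := by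
  have hmono : StrictMono (jU hU) := fun a b hab =>
    (ordRank_lt_ordRank_iff hU).2 (Filter.univ_mem' fun _ => hab)
  exact hmono.le_apply

theorem ordRank_surjective (hU : IsNormalUltrafilter δ U) :
    Function.Surjective (ordRank hU) := by
  intro o
  have ho := Ordinal.lift_le.{1}.2 (le_jU hU o)
  rw [jU, lift_ordRank] at ho
  obtain ⟨g, hg, hgo⟩ := Acc.mem_range_rank_of_le _ ho
  refine ⟨g, Ordinal.lift_inj.{1}.1 ?_⟩
  rw [lift_ordRank, hgo]

/-- If almost every `f i` has cofinality above `μ`, then so does the ordinal represented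
by `f`. -/
theorem lt_cof_ordRank (hU : IsNormalUltrafilter δ U) {f : Idx δ → Ordinal.{0}}
    {μ : Cardinal.{0}} (h : { i | μ < (f i).cof } ∈ U) : μ < (ordRank hU f).cof := by
  by_contra! hle
  obtain ⟨S, hS, hSc⟩ := Order.exists_cof_eq (Iio (ordRank hU f))
  rw [Ordinal.cof_Iio, ← Ordinal.lift_cof] at hSc
  choose g hg using fun s : S => ordRank_surjective hU s.1.1
  have hgf : ∀ s, ultLT U (g s) f := fun s =>
    (ordRank_lt_ordRank_iff hU).1 ((hg s).trans_lt s.1.2)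
  let G : Idx δ → Ordinal.{0} := fun i => ⨆ s, (if g s i < f i then g s i else 0) + 1
  have hsmall : Small.{0} S := by
    rw [Cardinal.small_iff_lift_mk_lt_univ, hSc]
    rw [Cardinal.lift_lift]
    exact Cardinal.lift_lt_univ _
  have hG : ultLT U G f := by
    filter_upwards [h] with i hi
    refine Ordinal.lift_iSup_add_one_lt_of_lt_cof ?_ fun s => ?_
    · rw [hSc, ← Ordinal.lift_cof, Cardinal.lift_id'.{0, 1}, Cardinal.lift_lt]
      exact hle.trans_lt hi
    · split_ifs with hs
      · exact hs
      · exact Ordinal.cof_pos.1 (pos_of_gt hi)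
  obtain ⟨s, hs, hGs⟩ := hS ⟨ordRank hU G, (ordRank_lt_ordRank_iff hU).2 hG⟩
  have hlt : ordRank hU (g ⟨s, hs⟩) < ordRank hU G := by
    rw [ordRank_lt_ordRank_iff]
    filter_upwards [hgf ⟨s, hs⟩] with i hi
    have := le_ciSup (f := fun s => (if g s i < f i then g s i else 0) + 1)
      Ordinal.bddAbove_of_small ⟨s, hs⟩
    simp only [if_pos hi] at this
    exact (lt_add_one _).trans_le this
  rw [hg] at hlt
  exact hlt.not_ge hGs

theorem setOf_le_mem (hU : IsNormalUltrafilter δ U) (a : Idx δ) : { i | a ≤ i } ∈ U := by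
  let e : a.1.ToType ≃ Iio a.1 := (Ordinal.ToType.mk (o := a.1)).symm.toEquiv
  have := hU.complete a.1.ToType (fun x => { i | i.1 ≠ (e x).1 }) ?_ fun x => ?_
  · filter_upwards [this] with i hi
    by_contra! hlt
    exact Set.mem_iInter.1 hi (e.symm ⟨i.1, hlt⟩) (by simp)
  · rw [Cardinal.mk_toType]
    exact Cardinal.lt_ord.1 a.2
  · have := Ultrafilter.compl_mem_iff_notMem.2
      (hU.nonprincipal ⟨(e x).1, lt_trans (e x).2 a.2⟩)
    filter_upwards [this] with i hi h
    exact hi (Subtype.ext h)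

/-- An ordinal of cofinality `δ` is the supremum of a `δ`-sequence that is eventually above
each smaller ordinal. -/
theorem exists_forall_setOf_le_mem (hU : IsNormalUltrafilter δ U) {o : Ordinal.{0}}
    (ho : o.cof = δ) : ∃ c : Idx δ → Ordinal.{0}, (∀ i, c i < o) ∧
      ∀ b < o, { i | b ≤ c i } ∈ U := by
  obtain ⟨S, hS, hSc⟩ := Order.exists_cof_eq (Iio o)
  rw [Ordinal.cof_Iio, ← Ordinal.lift_cof, ho, ← mk_idx] at hSc
  obtain ⟨e⟩ := Cardinal.eq.1 hSc
  have hlim : Order.IsSuccLimit δ.ord := Cardinal.isSuccLimit_ord hU.uncountable.le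
  refine ⟨fun i => ⨆ j : Iic i, (e.symm j.1).1.1, fun i => ?_, fun b hb => ?_⟩
  · refine Ordinal.lift_iSup_lt_of_lt_cof ?_ fun j => (e.symm j.1).1.2
    rw [← Ordinal.lift_cof, ho, Cardinal.lift_id'.{0, 1}]
    have hle : #(Iic i) ≤ #(Iio (i.1 + 1)) := by
      refine Cardinal.mk_le_of_injective
        (f := fun j => ⟨j.1.1, Set.mem_Iio.2 (Order.lt_add_one_iff.2 j.2)⟩) fun j k hjk => ?_
      exact Subtype.ext (Subtype.ext (congrArg (fun x => x.1) hjk))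
    refine hle.trans_lt ?_
    rw [Cardinal.mk_Iio_ordinal, Cardinal.lift_lt]
    exact Cardinal.lt_ord.1 (hlim.add_one_lt i.2)
  · obtain ⟨s, hs, hbs⟩ := hS ⟨b, hb⟩
    filter_upwards [setOf_le_mem hU (e ⟨s, hs⟩)] with i hi
    have := le_ciSup (f := fun j : Iic i => (e.symm j.1).1.1)
      Ordinal.bddAbove_of_small ⟨e ⟨s, hs⟩, hi⟩
    simp only [Equiv.symm_apply_apply] at this
    exact (show b ≤ s.1 from hbs).trans this

theorem power_lt_of_isStrongLimit {κ a b : Cardinal.{0}} (hκ : κ.IsStrongLimit)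
    (ha : a < κ) (hb : b < κ) : a ^ b < κ := by
  calc a ^ b ≤ (2 ^ a) ^ b := Cardinal.power_le_power_right (Cardinal.cantor a).le
    _ = 2 ^ (a * b) := (Cardinal.power_mul).symm
    _ < κ := hκ.isStrongPrelimit (Cardinal.mul_lt_of_lt hκ.aleph0_le ha hb)

/-- The product of the cardinals `|c i| ^ δ`, for `c` cofinal in `o`, has at least
`|o| ^ δ` elements modulo `U`. -/
theorem power_le_card_ordRank (hU : IsNormalUltrafilter δ U) {o : Ordinal.{0}}
    {c : Idx δ → Ordinal.{0}} (hc : ∀ b < o, { i | b ≤ c i } ∈ U) :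
    o.card ^ δ ≤ (ordRank hU fun i => ((c i + 1).card ^ δ).ord).card := by
  have hcode : ∀ i, Nonempty ((Idx δ → Iio (c i + 1)) ≃ Iio ((c i + 1).card ^ δ).ord) := by
    intro i
    rw [← Cardinal.eq, mk_idx_fun, Cardinal.mk_Iio_ordinal, Cardinal.card_ord]
  let e := fun i => (hcode i).some
  let code : (Idx δ → Iio o) → Idx δ → Ordinal.{0} := fun x i =>
    (e i fun a => ⟨min (x a).1 (c i),
      Set.mem_Iio.2 (Order.lt_add_one_iff.2 (min_le_right _ _))⟩).1
  have hlt : ∀ x, ordRank hU (code x) < ordRank hU fun i => ((c i + 1).card ^ δ).ord :=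
    fun x => (ordRank_lt_ordRank_iff hU).2 (Filter.univ_mem' fun i => (e i _).2)
  have hinj : Function.Injective fun x =>
      (⟨ordRank hU (code x), hlt x⟩ : Iio (ordRank hU fun i => ((c i + 1).card ^ δ).ord)) := by
    intro x y hxy
    have hxy' := (ordRank_eq_ordRank_iff hU).1 (congrArg Subtype.val hxy)
    funext a
    obtain ⟨i, hi, hxi, hyi⟩ := Ultrafilter.nonempty_of_mem
      (Filter.inter_mem hxy' (Filter.inter_mem (hc _ (x a).2) (hc _ (y a).2)))
    have h := congrArg Subtype.val (congrFun ((e i).injective (Subtype.ext hi)) a)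
    simp only [Set.mem_ofPred_eq] at hxi hyi
    simpa only [min_eq_left hxi, min_eq_left hyi, Subtype.coe_inj] using h
  have := Cardinal.mk_le_of_injective hinj
  rwa [mk_idx_fun, Cardinal.mk_Iio_ordinal, Cardinal.lift_le] at this

/-- The ultrapower computes cardinal successors pointwise. -/
theorem succInUlt_ordRank (hU : IsNormalUltrafilter δ U) (k : Idx δ → Ordinal.{0}) :
    succInUlt hU (ordRank hU k) = ordRank hU fun i => (Order.succ (k i).card).ord := by
  refine IsLeast.csInf_eq ⟨⟨?_, _, rfl, Filter.univ_mem' fun i => ?_⟩, ?_⟩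
  · exact (ordRank_lt_ordRank_iff hU).2
      (Filter.univ_mem' fun i => Cardinal.lt_ord.2 (Order.lt_succ _))
  · simp
  · rintro _ ⟨hlt, h, rfl, hcard⟩
    rw [ordRank_le_ordRank_iff]
    rw [ordRank_lt_ordRank_iff] at hlt
    filter_upwards [hlt, hcard] with i hi hi'
    rw [← hi', Cardinal.ord_le_ord]
    rw [← hi', Cardinal.lt_ord] at hi
    exact Order.succ_le_of_lt hi

/-- If `κ` is a singular strong limit cardinal of cofinality `δ` with `κ^δ = κ⁺`,
then the ordinal `λ = ((κ⁺)⁺)^{Ult(V,U)}` satisfies `λ < (κ⁺)⁺` and `cof(λ) = κ⁺`. -/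
theorem stmt19 (δ : Cardinal.{0}) (U : Ultrafilter (Idx δ)) (hU : IsNormalUltrafilter δ U)
    (κ : Cardinal.{0}) (hsing : IsSingular κ) (hsl : κ.IsStrongLimit)
    (hcof : κ.ord.cof = δ) (hsch : κ ^ δ = Order.succ κ) :
    succInUlt hU (Order.succ κ).ord < (Order.succ (Order.succ κ)).ord ∧
      (succInUlt hU (Order.succ κ).ord).cof = Order.succ κ := by
  have hδκ : δ < κ := hcof ▸ hsing.2
  obtain ⟨k, hk⟩ := ordRank_surjective hU (Order.succ κ).ord
  have hcof_lt : ∀ μ < κ, μ < (succInUlt hU (Order.succ κ).ord).cof := by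
    intro μ hμ
    rw [← hk, succInUlt_ordRank]
    refine lt_cof_ordRank hU ?_
    have hμ' : max μ ℵ₀ < κ := max_lt hμ (hU.uncountable.trans hδκ)
    have hle : ordRank hU (fun _ => (max μ ℵ₀).ord) ≤ ordRank hU k := by
      rw [hk]
      refine le_of_lt (Cardinal.lt_ord.2 (lt_of_le_of_lt ?_ (Order.lt_succ κ)))
      have hlim := Cardinal.isSuccLimit_ord hsing.1
      refine (card_ordRank_le hU (o := (max μ ℵ₀).ord + 1)
        (Filter.univ_mem' fun _ => Set.mem_ofPred.2 (lt_add_one _))).trans ?_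
      refine (power_lt_of_isStrongLimit hsl (Cardinal.lt_ord.1 ?_) hδκ).le
      exact hlim.add_one_lt (Cardinal.ord_lt_ord.2 hμ')
    filter_upwards [(ordRank_le_ordRank_iff hU).1 hle] with i hi
    have hi' := Cardinal.ord_le.1 hi
    rw [(Cardinal.isRegular_succ ((le_max_right _ _).trans hi')).cof_ord]
    exact Order.lt_succ_of_le ((le_max_left _ _).trans hi')
  have hcard : (succInUlt hU (Order.succ κ).ord).card ≤ Order.succ κ := by
    obtain ⟨c, hcκ, hc⟩ := exists_forall_setOf_le_mem hU hcof
    have hkc := power_le_card_ordRank hU hc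
    rw [Cardinal.card_ord, hsch, ← Cardinal.ord_le, ← hk, ordRank_le_ordRank_iff] at hkc
    rw [← hk, succInUlt_ordRank, ← hsch, ← Cardinal.card_ord κ]
    refine card_ordRank_le hU ?_
    filter_upwards [hkc] with i hi
    rw [Cardinal.ord_lt_ord]
    refine hsl.isSuccLimit.succ_lt (lt_of_le_of_lt (Ordinal.card_le_card hi) ?_)
    rw [Cardinal.card_ord]
    refine power_lt_of_isStrongLimit hsl (Cardinal.lt_ord.1 ?_) hδκ
    exact (Cardinal.isSuccLimit_ord hsing.1).add_one_lt (hcκ i)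
  refine ⟨Cardinal.lt_ord.2 (hcard.trans_lt (Order.lt_succ _)), ?_⟩
  refine le_antisymm ((Ordinal.cof_le_card _).trans hcard) (Order.succ_le_of_lt ?_)
  refine lt_of_le_of_ne (le_of_forall_lt hcof_lt) fun h => hsing.2.ne ?_
  rw [h, Ordinal.cof_ord_cof]

end MU
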